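/- arXiv:2210.16915 — 7 statements merged into one kernel-verified Lean document; each statement's English description precedes it below -/
import Mathlib

section
/- Let S, Aα, Aν be nonempty finite types, P a transition function, πν a fixed victim policy, rν : S → ℝ a reward, γ ∈ [0,1) a discount factor, and s₀ ∈ S an initial state. Let πα and π̃α be adversary policies with π̃α s aα > 0 for all s, aα. Let V be a value function for (rν, Q[πα, πν]) and Ṽ a value function for (rν, Q[π̃α, πν]), and set H = max_{s ∈ S} |V s|. Then |Ṽ s₀ − V s₀| ≤ (γ · H · √(2 · ln 2) / (1 − γ)) · max_{s ∈ S} √(D_KL(πα s ‖ π̃α s)). (This is Lemma 2 of the paper: the gap in the victim's expected discounted reward between two adversary policies is bounded by the maximal square-root KL divergence between them.) -/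
open Finset

/-- Base-2 KL divergence between probability vectors on a finite type. -/
noncomputable def klDiv {A : Type*} [Fintype A] (p q : A → ℝ) : ℝ :=
  ∑ a, p a * Real.logb 2 (p a / q a)

/-- The Padé-type lower bound on the logarithm behind Pinsker's inequality. -/
lemma sub_one_mul_div_le_log {x : ℝ} (hx : 0 < x) :
    (x - 1) * (5 * x + 1) / (2 * x * (x + 2)) ≤ Real.log x := by
  set f : ℝ → ℝ := fun y => Real.log y - (y - 1) * (5 * y + 1) / (2 * y * (y + 2)) with hf
  have hderiv : ∀ y : ℝ, 0 < y → HasDerivAt f ((y - 1) ^ 3 / (y ^ 2 * (y + 2) ^ 2)) y := by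
    intro y hy
    have hnum : HasDerivAt (fun y : ℝ => (y - 1) * (5 * y + 1))
        (1 * (5 * y + 1) + (y - 1) * (5 * 1)) y :=
      ((hasDerivAt_id' y).sub_const 1).mul (((hasDerivAt_id' y).const_mul 5).add_const 1)
    have hden : HasDerivAt (fun y : ℝ => 2 * y * (y + 2))
        (2 * 1 * (y + 2) + 2 * y * 1) y :=
      ((hasDerivAt_id' y).const_mul 2).mul ((hasDerivAt_id' y).add_const 2)
    have hne : 2 * y * (y + 2) ≠ 0 := by positivity
    refine ((Real.hasDerivAt_log hy.ne').sub (hnum.div hden hne)).congr_deriv ?_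
    field_simp
    ring
  have hf1 : f 1 = 0 := by simp [hf]
  have hfx : 0 ≤ f x := by
    rcases le_total x 1 with h | h
    · have hanti : AntitoneOn f (Set.Icc x 1) := by
        refine antitoneOn_of_hasDerivWithinAt_nonpos (convex_Icc x 1)
          (fun y hy => (hderiv y (hx.trans_le hy.1)).continuousAt.continuousWithinAt)
          (fun y hy => (hderiv y (hx.trans_le (interior_subset hy).1)).hasDerivWithinAt) ?_
        intro y hy
        have hy' := interior_subset hy
        refine div_nonpos_of_nonpos_of_nonneg ?_ (by positivity)
        exact Odd.pow_nonpos (by decide) (by linarith [hy'.2])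
      simpa [hf1] using hanti ⟨le_rfl, h⟩ ⟨h, le_rfl⟩ h
    · have hmono : MonotoneOn f (Set.Icc 1 x) := by
        refine monotoneOn_of_hasDerivWithinAt_nonneg (convex_Icc 1 x)
          (fun y hy => (hderiv y (one_pos.trans_le hy.1)).continuousAt.continuousWithinAt)
          (fun y hy =>
            (hderiv y (one_pos.trans_le (interior_subset hy).1)).hasDerivWithinAt) ?_
        intro y hy
        have hy' : 0 ≤ y - 1 := by linarith [(interior_subset hy).1]
        positivity
      simpa [hf1] using hmono ⟨le_rfl, h⟩ ⟨h, le_rfl⟩ h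
  simp only [hf] at hfx
  linarith

lemma three_mul_sq_sub_div_le {p q : ℝ} (hp : 0 ≤ p) (hq : 0 < q) :
    3 * (p - q) ^ 2 / (2 * (p + 2 * q)) ≤ p * Real.log (p / q) - p + q := by
  rcases hp.eq_or_lt with rfl | hp
  · rw [div_le_iff₀ (by positivity)]
    simp only [zero_mul]
    nlinarith [sq_nonneg q]
  · have h := mul_le_mul_of_nonneg_left (sub_one_mul_div_le_log (div_pos hp hq)) hp.le
    have e : 3 * (p - q) ^ 2 / (2 * (p + 2 * q)) =
        p * ((p / q - 1) * (5 * (p / q) + 1) / (2 * (p / q) * (p / q + 2))) - p + q := by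
      field_simp
      ring
    rw [e]
    linarith

/-- Pinsker's inequality for finite probability vectors, in base 2. -/
lemma sum_abs_sub_le_sqrt_klDiv {A : Type*} [Fintype A] (p q : A → ℝ)
    (hp : ∀ a, 0 ≤ p a) (hpsum : ∑ a, p a = 1) (hq : ∀ a, 0 < q a) (hqsum : ∑ a, q a = 1) :
    ∑ a, |q a - p a| ≤ √(2 * Real.log 2) * √(klDiv p q) := by
  have hlog : Real.log 2 * klDiv p q = ∑ a, p a * Real.log (p a / q a) := by
    have h2 : Real.log 2 ≠ 0 := (Real.log_pos one_lt_two).ne'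
    simp only [klDiv, Real.logb, mul_sum]
    refine sum_congr rfl fun a _ => ?_
    field_simp
  have hle : ∑ a, 3 * (p a - q a) ^ 2 / (2 * (p a + 2 * q a)) ≤ Real.log 2 * klDiv p q := by
    calc _ ≤ ∑ a, (p a * Real.log (p a / q a) - p a + q a) :=
          sum_le_sum fun a _ => three_mul_sq_sub_div_le (hp a) (hq a)
      _ = _ := by rw [sum_add_distrib, sum_sub_distrib, hpsum, hqsum, hlog]; ring
  have hpos : ∀ a, 0 < p a + 2 * q a := fun a => by linarith [hp a, hq a]
  have hcs := sum_sq_le_sum_mul_sum_of_sq_le_mul univ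
    (r := fun a => |q a - p a|) (f := fun a => 3 * (p a - q a) ^ 2 / (2 * (p a + 2 * q a)))
    (g := fun a => 2 / 3 * (p a + 2 * q a))
    (fun a _ => div_nonneg (by positivity) (by linarith [hpos a]))
    (fun a _ => by linarith [hpos a])
    (fun a _ => by
      have := (hpos a).ne'
      rw [sq_abs]
      generalize p a + 2 * q a = d at this ⊢
      apply le_of_eq
      field_simp
      ring)
  have hg : ∑ a, 2 / 3 * (p a + 2 * q a) = 2 := by
    rw [← mul_sum, sum_add_distrib, ← mul_sum, hpsum, hqsum]; norm_num
  rw [hg] at hcs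
  rw [← Real.sqrt_mul (by positivity)]
  apply Real.le_sqrt_of_sq_le
  linarith

lemma abs_sum_mul_le_of_sum_eq_one {A : Type*} [Fintype A] {w f : A → ℝ} {C : ℝ}
    (hw : ∀ a, 0 ≤ w a) (hsum : ∑ a, w a = 1) (hf : ∀ a, |f a| ≤ C) :
    |∑ a, w a * f a| ≤ C := by
  calc |∑ a, w a * f a| ≤ ∑ a, |w a * f a| := abs_sum_le_sum_abs _ _
    _ ≤ ∑ a, w a * C := sum_le_sum fun a _ => by
        rw [abs_mul, abs_of_nonneg (hw a)]
        exact mul_le_mul_of_nonneg_left (hf a) (hw a)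
    _ = C := by rw [← sum_mul, hsum, one_mul]

theorem victim_return_gap_KL_bound
    {S Aα Aν : Type*} [Fintype S] [Nonempty S] [Fintype Aα] [Nonempty Aα]
    [Fintype Aν] [Nonempty Aν]
    (P : S → Aα → Aν → S → ℝ)
    (hPnn : ∀ s aα aν s', 0 ≤ P s aα aν s')
    (hPsum : ∀ s aα aν, ∑ s', P s aα aν s' = 1)
    (πν : S → Aν → ℝ)
    (hπνnn : ∀ s aν, 0 ≤ πν s aν) (hπνsum : ∀ s, ∑ aν, πν s aν = 1)
    (rν : S → ℝ) (γ : ℝ) (hγ0 : 0 ≤ γ) (hγ1 : γ < 1) (s₀ : S)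
    (πα πα' : S → Aα → ℝ)
    (hπαnn : ∀ s aα, 0 ≤ πα s aα) (hπαsum : ∀ s, ∑ aα, πα s aα = 1)
    (hπα'pos : ∀ s aα, 0 < πα' s aα) (hπα'sum : ∀ s, ∑ aα, πα' s aα = 1)
    (V V' : S → ℝ)
    (hV : ∀ s, V s = rν s +
      γ * ∑ s', (∑ aα, ∑ aν, πα s aα * πν s aν * P s aα aν s') * V s')
    (hV' : ∀ s, V' s = rν s +
      γ * ∑ s', (∑ aα, ∑ aν, πα' s aα * πν s aν * P s aα aν s') * V' s')
    (H : ℝ) (hH : H = ⨆ s, |V s|) :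
    |V' s₀ - V s₀| ≤
      γ * H * Real.sqrt (2 * Real.log 2) / (1 - γ) *
        ⨆ s, Real.sqrt (klDiv (πα s) (πα' s)) := by
  set g : (S → ℝ) → S → Aα → ℝ :=
    fun W s a => ∑ b, πν s b * ∑ s', P s a b s' * W s' with hg
  have hkernel : ∀ (π : S → Aα → ℝ) (W : S → ℝ) (s : S),
      ∑ s', (∑ aα, ∑ aν, π s aα * πν s aν * P s aα aν s') * W s' = ∑ a, π s a * g W s a := by
    intro π W s
    simp only [hg, sum_mul, mul_sum]
    rw [sum_comm]
    refine sum_congr rfl fun a _ => ?_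
    rw [sum_comm]
    exact sum_congr rfl fun b _ => sum_congr rfl fun s' _ => by ring
  have hg_le : ∀ (W : S → ℝ) (C : ℝ), (∀ s, |W s| ≤ C) → ∀ s a, |g W s a| ≤ C :=
    fun W C hW s a => abs_sum_mul_le_of_sum_eq_one (hπνnn s) (hπνsum s) fun b =>
      abs_sum_mul_le_of_sum_eq_one (hPnn s a b) (hPsum s a b) hW
  have hg_sub : ∀ s a, g (fun t => V' t - V t) s a = g V' s a - g V s a := by
    intro s a
    simp only [hg, mul_sub, sum_sub_distrib]
  have hVH : ∀ s, |V s| ≤ H := fun s => hH ▸ le_ciSup (Set.finite_range fun s => |V s|).bddAbove s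
  have hH0 : 0 ≤ H := (abs_nonneg _).trans (hVH s₀)
  set K := ⨆ s, √(klDiv (πα s) (πα' s)) with hK
  have hKs : ∀ s, √(klDiv (πα s) (πα' s)) ≤ K := fun s =>
    le_ciSup (Set.finite_range fun s => √(klDiv (πα s) (πα' s))).bddAbove s
  obtain ⟨m, hm⟩ := Finite.exists_max fun s => |V' s - V s|
  have hdecomp : V' m - V m = γ * (∑ a, πα' m a * g (fun t => V' t - V t) m a +
      ∑ a, (πα' m a - πα m a) * g V m a) := by
    rw [hV' m, hV m, hkernel, hkernel, ← sum_add_distrib, add_sub_add_left_eq_sub, ← mul_sub,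
      ← sum_sub_distrib]
    congr 1
    refine sum_congr rfl fun a _ => ?_
    rw [hg_sub]
    ring
  have hfirst : |∑ a, πα' m a * g (fun t => V' t - V t) m a| ≤ |V' m - V m| :=
    abs_sum_mul_le_of_sum_eq_one (fun a => (hπα'pos m a).le) (hπα'sum m) (hg_le _ _ hm m)
  have hsecond : |∑ a, (πα' m a - πα m a) * g V m a| ≤ √(2 * Real.log 2) * K * H := by
    calc _ ≤ ∑ a, |(πα' m a - πα m a) * g V m a| := abs_sum_le_sum_abs _ _
      _ ≤ ∑ a, |πα' m a - πα m a| * H := sum_le_sum fun a _ => by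
          rw [abs_mul]
          exact mul_le_mul_of_nonneg_left (hg_le V H hVH m a) (abs_nonneg _)
      _ ≤ √(2 * Real.log 2) * K * H := by
          rw [← sum_mul]
          gcongr
          exact (sum_abs_sub_le_sqrt_klDiv _ _ (hπαnn m) (hπαsum m) (hπα'pos m) (hπα'sum m)).trans
            (mul_le_mul_of_nonneg_left (hKs m) (Real.sqrt_nonneg _))
  have hmax : |V' m - V m| ≤ γ * (|V' m - V m| + √(2 * Real.log 2) * K * H) := by
    conv_lhs => rw [hdecomp, abs_mul, abs_of_nonneg hγ0]
    exact mul_le_mul_of_nonneg_left ((abs_add_le _ _).trans (add_le_add hfirst hsecond)) hγ0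
  refine (hm s₀).trans ?_
  rw [div_mul_eq_mul_div, le_div_iff₀ (by linarith)]
  linarith
end

section
/- Let S be a nonempty finite type, γ ∈ [0,1), r : S → ℝ, s₀ ∈ S, and let Q and Q̃ be stochastic kernels on S. Let V be a value function for (r, Q) and Ṽ a value function for (r, Q̃). Define the competitive advantage A(s, s') = r s + γ · V s' − V s, and the state distributions under Q̃ by μ₀ = the indicator of s₀ and μ_{t+1} s' = Σ_s μ_t s · Q̃ s s'. Then the series Σ_{t=0}^∞ γ^t · (Σ_s μ_t s · Σ_{s'} Q̃ s s' · A(s, s')) converges and equals Ṽ s₀ − V s₀. (This is the performance-difference identity used in the proof of Lemma 2, expressing the return gap between two kernels as the expected discounted sum of competitive advantages.) -/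
open Finset

/-- A series whose terms are the successive differences of a summable sequence telescopes. -/
theorem Summable.hasSum_sub_succ {a : ℕ → ℝ} (ha : Summable a) :
    HasSum (fun t => a t - a (t + 1)) (a 0) := by
  have h := ha.hasSum.sub ((hasSum_nat_add_iff' 1).mpr ha.hasSum)
  simpa using h

theorem sum_iterate_kernel_mul {S : Type*} [Fintype S] {Q : S → S → ℝ} {μ : ℕ → S → ℝ}
    (hμ : ∀ t s', μ (t + 1) s' = ∑ s, μ t s * Q s s') (f : S → ℝ) (t : ℕ) :
    ∑ s, μ (t + 1) s * f s = ∑ s, μ t s * ∑ s', Q s s' * f s' := by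
  simp only [hμ, sum_mul, mul_sum, mul_assoc]
  exact sum_comm

theorem iterate_kernel_nonneg {S : Type*} [Fintype S] {Q : S → S → ℝ} {μ : ℕ → S → ℝ}
    (hQ : ∀ s s', 0 ≤ Q s s') (hμ0 : ∀ s, 0 ≤ μ 0 s)
    (hμ : ∀ t s', μ (t + 1) s' = ∑ s, μ t s * Q s s') (t : ℕ) (s : S) : 0 ≤ μ t s := by
  induction t generalizing s with
  | zero => exact hμ0 s
  | succ t ih =>
    rw [hμ]
    exact sum_nonneg fun x _ => mul_nonneg (ih x) (hQ x s)

theorem sum_iterate_kernel {S : Type*} [Fintype S] {Q : S → S → ℝ} {μ : ℕ → S → ℝ}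
    (hQ : ∀ s, ∑ s', Q s s' = 1)
    (hμ : ∀ t s', μ (t + 1) s' = ∑ s, μ t s * Q s s') (t : ℕ) :
    ∑ s, μ t s = ∑ s, μ 0 s := by
  induction t with
  | zero => rfl
  | succ t ih => simpa [hQ, ih] using sum_iterate_kernel_mul hμ (fun _ => 1) t

/-- Discounted expectations along a sequence of probability vectors are summable. -/
theorem summable_discounted_expectation {S : Type*} [Fintype S] {γ : ℝ} (hγ0 : 0 ≤ γ)
    (hγ1 : γ < 1) {μ : ℕ → S → ℝ} (hnn : ∀ t s, 0 ≤ μ t s) (hsum : ∀ t, ∑ s, μ t s = 1)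
    (f : S → ℝ) : Summable fun t => γ ^ t * ∑ s, μ t s * f s := by
  refine Summable.of_norm_bounded
    ((summable_geometric_of_lt_one hγ0 hγ1).mul_right (∑ s, |f s|)) fun t => ?_
  rw [norm_mul, Real.norm_of_nonneg (pow_nonneg hγ0 t)]
  refine mul_le_mul_of_nonneg_left ?_ (pow_nonneg hγ0 t)
  refine (norm_sum_le _ _).trans (sum_le_sum fun s _ => ?_)
  have hle : μ t s ≤ 1 :=
    hsum t ▸ single_le_sum (f := μ t) (fun x _ => hnn t x) (mem_univ s)
  rw [norm_mul, Real.norm_of_nonneg (hnn t s)]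
  exact mul_le_of_le_one_left (norm_nonneg _) hle

theorem performance_difference_identity
    {S : Type*} [Fintype S] [Nonempty S] [DecidableEq S]
    (γ : ℝ) (hγ0 : 0 ≤ γ) (hγ1 : γ < 1) (r : S → ℝ) (s₀ : S)
    (Q Q' : S → S → ℝ)
    (hQnn : ∀ s s', 0 ≤ Q s s') (hQsum : ∀ s, ∑ s', Q s s' = 1)
    (hQ'nn : ∀ s s', 0 ≤ Q' s s') (hQ'sum : ∀ s, ∑ s', Q' s s' = 1)
    (V V' : S → ℝ)
    (hV : ∀ s, V s = r s + γ * ∑ s', Q s s' * V s')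
    (hV' : ∀ s, V' s = r s + γ * ∑ s', Q' s s' * V' s')
    (μ : ℕ → S → ℝ)
    (hμ0 : ∀ s, μ 0 s = if s = s₀ then 1 else 0)
    (hμsucc : ∀ t s', μ (t + 1) s' = ∑ s, μ t s * Q' s s') :
    HasSum
      (fun t : ℕ => γ ^ t *
        ∑ s, μ t s * ∑ s', Q' s s' * (r s + γ * V s' - V s))
      (V' s₀ - V s₀) := by
  have hnn := iterate_kernel_nonneg hQ'nn (fun s => by rw [hμ0]; split_ifs <;> simp) hμsucc
  have hsum : ∀ t, ∑ s, μ t s = 1 := fun t => by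
    rw [sum_iterate_kernel hQ'sum hμsucc]
    simp [hμ0]
  have key := (summable_discounted_expectation hγ0 hγ1 hnn hsum
    (fun s => V' s - V s)).hasSum_sub_succ
  have h_adv : ∀ s, ∑ s', Q' s s' * (r s + γ * V s' - V s) =
      (V' s - V s) - γ * ∑ s', Q' s s' * (V' s' - V s') := fun s => by
    have h_split : ∑ s', Q' s s' * (r s + γ * V s' - V s) =
        (∑ s', Q' s s') * (r s - V s) + γ * ∑ s', Q' s s' * V s' := by
      rw [sum_mul, mul_sum, ← sum_add_distrib]
      exact sum_congr rfl fun s' _ => by ring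
    rw [h_split, hQ'sum]
    simp only [mul_sub, sum_sub_distrib]
    linarith [hV' s]
  convert key using 1
  · funext t
    rw [sum_iterate_kernel_mul hμsucc, pow_succ, mul_assoc, ← mul_sub]
    congr 1
    rw [mul_sum, ← sum_sub_distrib]
    refine sum_congr rfl fun s _ => ?_
    rw [h_adv]
    ring
  · simp [hμ0]
end

section
/- Let S be a nonempty finite type, γ ∈ [0,1), r : S → ℝ, s₀ ∈ S, and let Q and Q̃ be stochastic kernels on S. Let V be a value function for (r, Q) and Ṽ a value function for (r, Q̃), and define A(s, s') = r s + γ · V s' − V s. If ε ≥ 0 satisfies |Σ_{s'} Q̃ s s' · A(s, s')| ≤ ε for every s ∈ S, then |Ṽ s₀ − V s₀| ≤ ε / (1 − γ). (This is inequality (eq. lm2-proof-eq3) in the proof of Lemma 2: a uniform per-state bound ε on the expected competitive advantage yields an ε/(1−γ) bound on the return gap.) -/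
open Finset

/-- Averaging with respect to a probability vector does not exceed a uniform bound. -/
theorem abs_sum_mul_le_of_forall_abs_le {S : Type*} [Fintype S] (p f : S → ℝ) (M : ℝ)
    (hp : ∀ s, 0 ≤ p s) (hsum : ∑ s, p s = 1) (hf : ∀ s, |f s| ≤ M) :
    |∑ s, p s * f s| ≤ M :=
  calc |∑ s, p s * f s| ≤ ∑ s, |p s * f s| := abs_sum_le_sum_abs _ _
    _ ≤ ∑ s, p s * M := by
      refine sum_le_sum fun s _ => ?_
      rw [abs_mul, abs_of_nonneg (hp s)]
      exact mul_le_mul_of_nonneg_left (hf s) (hp s)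
    _ = M := by rw [← sum_mul, hsum, one_mul]

theorem advantage_bound_to_return_gap
    {S : Type*} [Fintype S] [Nonempty S]
    (γ : ℝ) (hγ0 : 0 ≤ γ) (hγ1 : γ < 1) (r : S → ℝ) (s₀ : S)
    (Q Q' : S → S → ℝ)
    (hQnn : ∀ s s', 0 ≤ Q s s') (hQsum : ∀ s, ∑ s', Q s s' = 1)
    (hQ'nn : ∀ s s', 0 ≤ Q' s s') (hQ'sum : ∀ s, ∑ s', Q' s s' = 1)
    (V V' : S → ℝ)
    (hV : ∀ s, V s = r s + γ * ∑ s', Q s s' * V s')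
    (hV' : ∀ s, V' s = r s + γ * ∑ s', Q' s s' * V' s')
    (ε : ℝ) (hε : 0 ≤ ε)
    (hadv : ∀ s, |∑ s', Q' s s' * (r s + γ * V s' - V s)| ≤ ε) :
    |V' s₀ - V s₀| ≤ ε / (1 - γ) := by
  obtain ⟨m, hm⟩ := Finite.exists_max fun s => |V' s - V s|
  have hgap : V' m - V m = ∑ s', Q' m s' * (r m + γ * V s' - V m)
      + γ * ∑ s', Q' m s' * (V' s' - V s') := by
    have hadv_eq : ∑ s', Q' m s' * (r m + γ * V s' - V m)
        = (∑ s', Q' m s') * (r m - V m) + γ * ∑ s', Q' m s' * V s' := by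
      rw [sum_mul, mul_sum, ← sum_add_distrib]
      exact sum_congr rfl fun s' _ => by ring
    rw [hadv_eq, hQ'sum, hV' m]
    simp only [mul_sub, sum_sub_distrib]
    ring
  have havg := abs_sum_mul_le_of_forall_abs_le (Q' m) (fun s => V' s - V s) _
    (hQ'nn m) (hQ'sum m) hm
  have hcontr : |V' m - V m| ≤ ε + γ * |V' m - V m| := by
    conv_lhs => rw [hgap]
    refine (abs_add_le _ _).trans (add_le_add (hadv m) ?_)
    rw [abs_mul, abs_of_nonneg hγ0]
    exact mul_le_mul_of_nonneg_left havg hγ0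
  refine (hm s₀).trans ?_
  rw [le_div_iff₀ (sub_pos.mpr hγ1)]
  linarith
end

section
/- Let S be a nonempty finite type, Q a stochastic kernel on S, γ ∈ [0,1), and r : S → ℝ. If V is a value function for (r, Q), then for every s ∈ S the series Σ_{t=0}^∞ γ^t · (Q^t r) s converges and equals V s, where Q^t denotes the t-fold iterate of the operator taking f : S → ℝ to s ↦ Σ_{s'} Q s s' · f s'. (This Neumann-series representation identifies the Bellman fixed point with the expected discounted sum of rewards along the Markov chain, the form in which the paper defines expected returns.) -/
open Finset

/-- If `T` sends combinations `g - c • h` to `T g - c • T h`, so do its iterates. -/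
theorem iterate_apply_of_eq_sub_smul {S : Type*} {T : (S → ℝ) → S → ℝ} {c : ℝ}
    (hT : ∀ g h : S → ℝ, T (g - c • h) = T g - c • T h) (g h : S → ℝ) (t : ℕ) :
    T^[t] (g - c • h) = T^[t] g - c • T^[t] h := by
  induction t with
  | zero => rfl
  | succ t ih => simp only [Function.iterate_succ_apply', ih, hT]

/-- Averaging against a stochastic kernel preserves uniform bounds. -/
theorem abs_iterate_kernel_le {S : Type*} [Fintype S] {Q : S → S → ℝ}
    (hQnn : ∀ s s', 0 ≤ Q s s') (hQsum : ∀ s, ∑ s', Q s s' = 1)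
    {f : S → ℝ} {M : ℝ} (hf : ∀ s, |f s| ≤ M) (t : ℕ) (s : S) :
    |((fun f : S → ℝ => fun s => ∑ s', Q s s' * f s')^[t] f) s| ≤ M := by
  induction t generalizing s with
  | zero => exact hf s
  | succ t ih =>
    rw [Function.iterate_succ_apply']
    refine (abs_sum_le_sum_abs _ _).trans ?_
    calc _ ≤ ∑ s', Q s s' * M := by
          refine sum_le_sum fun s' _ => ?_
          rw [abs_mul, abs_of_nonneg (hQnn s s')]
          exact mul_le_mul_of_nonneg_left (ih s') (hQnn s s')
      _ = M := by rw [← sum_mul, hQsum, one_mul]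

theorem value_function_neumann_series
    {S : Type*} [Fintype S] [Nonempty S]
    (Q : S → S → ℝ)
    (hQnn : ∀ s s', 0 ≤ Q s s') (hQsum : ∀ s, ∑ s', Q s s' = 1)
    (γ : ℝ) (hγ0 : 0 ≤ γ) (hγ1 : γ < 1)
    (r : S → ℝ)
    (V : S → ℝ) (hV : ∀ s, V s = r s + γ * ∑ s', Q s s' * V s') :
    ∀ s, HasSum
      (fun t : ℕ =>
        γ ^ t * ((fun f : S → ℝ => fun s => ∑ s', Q s s' * f s')^[t] r) s)
      (V s) := by
  intro s
  have summable : Summable fun t : ℕ =>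
      γ ^ t * ((fun f : S → ℝ => fun s => ∑ s', Q s s' * f s')^[t] V) s := by
    obtain ⟨M, hM⟩ : ∃ M, ∀ s, |V s| ≤ M :=
      ⟨∑ s, |V s|, fun s => single_le_sum (f := fun s => |V s|)
        (fun _ _ => abs_nonneg _) (mem_univ s)⟩
    refine .of_norm_bounded ((summable_geometric_of_lt_one hγ0 hγ1).mul_right M) fun t => ?_
    rw [Real.norm_eq_abs, abs_mul, abs_of_nonneg (pow_nonneg hγ0 t)]
    exact mul_le_mul_of_nonneg_left (abs_iterate_kernel_le hQnn hQsum hM t s)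
      (pow_nonneg hγ0 t)
  have hsum := summable.hasSum
  have hshift := (hasSum_nat_add_iff' 1).mpr hsum
  have hdiff := hsum.sub hshift
  simp only [sum_range_one, pow_zero, one_mul, Function.iterate_zero, id_eq,
    sub_sub_cancel] at hdiff
  refine (congrArg (HasSum · (V s)) (funext fun t => ?_)).mpr hdiff
  set T := fun f : S → ℝ => fun s => ∑ s', Q s s' * f s' with hTdef
  have hr : r = V - γ • T V := by
    ext s
    simp only [hTdef, Pi.sub_apply, Pi.smul_apply, smul_eq_mul]
    linarith [hV s]
  have hT : ∀ g h : S → ℝ, T (g - γ • h) = T g - γ • T h := by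
    intro g h
    ext s
    simp only [hTdef, Pi.sub_apply, Pi.smul_apply, smul_eq_mul, mul_sub, sum_sub_distrib,
      mul_sum, mul_left_comm]
  rw [hr, iterate_apply_of_eq_sub_smul hT, ← Function.iterate_succ_apply]
  simp only [Pi.sub_apply, Pi.smul_apply, smul_eq_mul, Nat.succ_eq_add_one, pow_succ]
  ring
end

section
/- Let X and Y be nonempty types, ε ≥ 0, and f, g : X → Y → ℝ with |f x y − g x y| ≤ ε for all x, y. Assume that for each x the functions y ↦ f x y and y ↦ g x y are bounded below, and that the functions x ↦ ⨅_y f x y and x ↦ ⨅_y g x y are bounded above. Suppose x* ∈ X attains the supremum, i.e. ⨅_y f x* y = ⨆_x ⨅_y f x y, and y* ∈ Y attains the infimum, i.e. f x* y* = ⨅_y f x* y. Then |g x* y* − ⨆_x ⨅_y g x y| ≤ 2ε. (This is the abstract max–min perturbation argument underlying Theorem 1: a saddle point of the objective trained with one adversary policy is 2Kε-optimal for the objective associated with the target adversary policy, where ε is the uniform gap between the two objectives.) -/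
open Finset

/-- If `f ≤ g + ε` pointwise, the max-min values satisfy the same inequality. -/
theorem ciSup_ciInf_le_ciSup_ciInf_add {X Y : Type*} [Nonempty X] [Nonempty Y]
    {ε : ℝ} {f g : X → Y → ℝ} (hfg : ∀ x y, f x y ≤ g x y + ε)
    (hf : ∀ x, BddBelow (Set.range (f x)))
    (hg : BddAbove (Set.range fun x => ⨅ y, g x y)) :
    (⨆ x, ⨅ y, f x y) ≤ (⨆ x, ⨅ y, g x y) + ε := by
  refine ciSup_le fun x => ?_
  have hinf : (⨅ y, f x y) - ε ≤ ⨅ y, g x y :=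
    le_ciInf fun y => by linarith [ciInf_le (hf x) y, hfg x y]
  linarith [le_ciSup hg x]

theorem maxmin_perturbation
    {X Y : Type*} [Nonempty X] [Nonempty Y]
    (ε : ℝ) (hε : 0 ≤ ε)
    (f g : X → Y → ℝ)
    (hfg : ∀ x y, |f x y - g x y| ≤ ε)
    (hfbdd : ∀ x, BddBelow (Set.range (f x)))
    (hgbdd : ∀ x, BddBelow (Set.range (g x)))
    (hfabove : BddAbove (Set.range fun x => ⨅ y, f x y))
    (hgabove : BddAbove (Set.range fun x => ⨅ y, g x y))
    (xs : X) (ys : Y)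
    (hxs : (⨅ y, f xs y) = ⨆ x, ⨅ y, f x y)
    (hys : f xs ys = ⨅ y, f xs y) :
    |g xs ys - ⨆ x, ⨅ y, g x y| ≤ 2 * ε := by
  have hfg' : ∀ x y, f x y ≤ g x y + ε ∧ g x y ≤ f x y + ε := fun x y => by
    have h := abs_le.mp (hfg x y)
    constructor <;> linarith
  have hle := ciSup_ciInf_le_ciSup_ciInf_add (fun x y => (hfg' x y).1) hfbdd hgabove
  have hge := ciSup_ciInf_le_ciSup_ciInf_add (fun x y => (hfg' x y).2) hgbdd hfabove
  obtain ⟨h₁, h₂⟩ := hfg' xs ys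
  rw [abs_le]
  constructor <;> linarith
end

section
/- Let T be a nonempty finite type (of trajectories) and n a natural number (the horizon). Let R : T → ℝ, c : T → ℝ with c τ ≥ 0 for all τ, and f : ℝ → T → Fin n → ℝ such that f ψ τ t > 0 for all ψ, τ, t and ψ ↦ f ψ τ t is differentiable for each τ, t. Define P ψ τ = c τ · Π_{t ∈ Fin n} f ψ τ t. Then for every ψ₀ ∈ ℝ, the function ψ ↦ Σ_τ R τ · P ψ τ is differentiable at ψ₀ and its derivative equals Σ_τ R τ · P ψ₀ τ · Σ_{t ∈ Fin n} deriv (fun ψ ↦ Real.log (f ψ τ t)) ψ₀. (This score-function identity is the content of Lemma 1 and Proposition 2: the gradient of an expected return over a parametrized trajectory distribution equals the expectation of the return times the sum of log-policy gradients, where c collects all parameter-independent factors such as the opponent's policy and the transition probabilities.) -/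
open Finset

/-- Logarithmic differentiation of a finite product of nonvanishing real functions. -/
theorem hasDerivAt_finsetProd_log {ι : Type*} (s : Finset ι) {g : ι → ℝ → ℝ} {x : ℝ}
    (hne : ∀ i ∈ s, g i x ≠ 0) (hg : ∀ i ∈ s, DifferentiableAt ℝ (g i) x) :
    HasDerivAt (fun y => ∏ i ∈ s, g i y)
      ((∏ i ∈ s, g i x) * ∑ i ∈ s, deriv (fun y => Real.log (g i y)) x) x := by
  classical
  refine (HasDerivAt.fun_finsetProd fun i hi => (hg i hi).hasDerivAt).congr_deriv ?_
  rw [mul_sum]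
  refine sum_congr rfl fun i hi => ?_
  rw [deriv.log (hg i hi) (hne i hi), ← mul_prod_erase s (fun j => g j x) hi, smul_eq_mul]
  field_simp [hne i hi]

theorem score_function_gradient_identity
    {T : Type*} [Fintype T] [Nonempty T] (n : ℕ)
    (R : T → ℝ) (c : T → ℝ) (hc : ∀ τ, 0 ≤ c τ)
    (f : ℝ → T → Fin n → ℝ)
    (hfpos : ∀ ψ τ t, 0 < f ψ τ t)
    (hfdiff : ∀ τ t, Differentiable ℝ (fun ψ => f ψ τ t))
    (P : ℝ → T → ℝ) (hP : ∀ ψ τ, P ψ τ = c τ * ∏ t : Fin n, f ψ τ t)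
    (ψ₀ : ℝ) :
    HasDerivAt (fun ψ => ∑ τ, R τ * P ψ τ)
      (∑ τ, R τ * P ψ₀ τ *
        ∑ t : Fin n, deriv (fun ψ => Real.log (f ψ τ t)) ψ₀) ψ₀ := by
  refine HasDerivAt.fun_sum fun τ _ => ?_
  simp only [hP]
  have h := hasDerivAt_finsetProd_log univ (g := fun t ψ => f ψ τ t) (x := ψ₀)
    (fun t _ => (hfpos ψ₀ τ t).ne') (fun t _ => hfdiff τ t ψ₀)
  exact ((h.const_mul (c τ)).const_mul (R τ)).congr_deriv (by ring)
end

section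
/- Let S, Aα, Aν be nonempty finite types, P a transition function, Δr : S → ℝ, γ ∈ [0,1), s₀ ∈ S, and let πν₀ be a victim policy with πν₀ s aν > 0 for all s, aν. For a victim policy πν define Λ(πν) = sSup { y : ℝ | ∃ an adversary policy πα and a value function V for (Δr, Q[πα, πν]) with y = V s₀ }. For ε > 0, let Ω(ε) be the set of victim policies πν with max_{s ∈ S} D_KL(πν s ‖ πν₀ s) ≤ ε, let Y(ε) = sInf { Λ(πν) | πν ∈ Ω(ε) }, and let Y* = Λ(πν₀). Then |Y(ε) − Y*| ≤ (γ · √(2 · ln 2) · max_{s ∈ S} |Δr s| / (1 − γ)²) · √ε. (This is Theorem 2 of the paper: the worst-case expected return of the adversary trained against victim policies in a KL-ball of radius ε around the true victim policy is within O(√ε) of the expected return obtained from training with the true victim policy.) -/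
open Finset

/-- The optimal adversary value `Λ(πν)`: the supremum, over adversary policies `πα`,
of the value at `s₀` of the value function for `(Δr, Q[πα, πν])`. -/
noncomputable def optAdvValue {S Aα Aν : Type*} [Fintype S] [Fintype Aα] [Fintype Aν]
    (P : S → Aα → Aν → S → ℝ) (Δr : S → ℝ) (γ : ℝ) (s₀ : S)
    (πν : S → Aν → ℝ) : ℝ :=
  sSup { y : ℝ | ∃ πα : S → Aα → ℝ,
    (∀ s aα, 0 ≤ πα s aα) ∧ (∀ s, ∑ aα, πα s aα = 1) ∧
    ∃ V : S → ℝ,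
      (∀ s, V s = Δr s +
        γ * ∑ s', (∑ aα, ∑ aν, πα s aα * πν s aν * P s aα aν s') * V s') ∧
      y = V s₀ }

section Pinsker

theorem div_le_log_of_pos {x : ℝ} (hx : 0 < x) :
    (5 * x ^ 2 - 4 * x - 1) / (2 * x ^ 2 + 4 * x) ≤ Real.log x := by
  let F : ℝ → ℝ := fun y => Real.log y - (5 * y ^ 2 - 4 * y - 1) / (2 * y ^ 2 + 4 * y)
  have hd : ∀ y : ℝ, 0 < y → HasDerivAt F ((y - 1) ^ 3 / (y ^ 2 * (y + 2) ^ 2)) y := by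
    intro y hy
    have hne : 2 * y ^ 2 + 4 * y ≠ 0 := by positivity
    have hnum : HasDerivAt (fun y : ℝ => 5 * y ^ 2 - 4 * y - 1) (10 * y - 4) y := by
      refine ((((hasDerivAt_pow 2 y).const_mul 5).sub
        ((hasDerivAt_id' y).const_mul 4)).sub_const 1).congr_deriv ?_
      norm_num
      ring
    have hden : HasDerivAt (fun y : ℝ => 2 * y ^ 2 + 4 * y) (4 * y + 4) y := by
      refine (((hasDerivAt_pow 2 y).const_mul 2).add
        ((hasDerivAt_id' y).const_mul 4)).congr_deriv ?_
      norm_num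
      ring
    refine ((Real.hasDerivAt_log hy.ne').sub (hnum.div hden hne)).congr_deriv ?_
    have h2 : y + 2 ≠ 0 := by positivity
    have hfac : 2 * y ^ 2 + 4 * y = 2 * y * (y + 2) := by ring
    rw [hfac]
    field_simp
    ring
  have hF1 : F 1 = 0 := by simp [F]; norm_num
  suffices 0 ≤ F x from sub_nonneg.mp this
  rw [← hF1]
  rcases le_total 1 x with h | h
  · refine monotoneOn_of_deriv_nonneg (convex_Ici 1)
      (fun y hy => (hd y (one_pos.trans_le hy)).continuousAt.continuousWithinAt)
      (fun y hy => ?_) (fun y hy => ?_) Set.self_mem_Ici h h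
    all_goals
      rw [interior_Ici, Set.mem_Ioi] at hy
      have hy0 : 0 < y := one_pos.trans hy
    · exact (hd y hy0).differentiableAt.differentiableWithinAt
    · rw [(hd y hy0).deriv]
      have := sub_pos.mpr hy
      positivity
  · refine antitoneOn_of_deriv_nonpos (convex_Ioc 0 1)
      (fun y hy => (hd y hy.1).continuousAt.continuousWithinAt)
      (fun y hy => ?_) (fun y hy => ?_) ⟨hx, h⟩ ⟨one_pos, le_rfl⟩ h
    all_goals rw [interior_Ioc] at hy
    · exact (hd y hy.1).differentiableAt.differentiableWithinAt
    · rw [(hd y hy.1).deriv]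
      refine div_nonpos_of_nonpos_of_nonneg ?_ (by positivity)
      exact Odd.pow_nonpos (by decide) (by linarith [hy.2])

theorem sq_sub_le_mul_log_div {p q : ℝ} (hp : 0 ≤ p) (hq : 0 < q) :
    (p - q) ^ 2 ≤ (2 * p + 4 * q) / 3 * (p * Real.log (p / q) - p + q) := by
  rcases hp.eq_or_lt with rfl | hp
  · simp only [zero_mul]
    nlinarith [sq_nonneg q]
  · have h := div_le_log_of_pos (div_pos hp hq)
    have hrw : (5 * (p / q) ^ 2 - 4 * (p / q) - 1) / (2 * (p / q) ^ 2 + 4 * (p / q)) =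
        (5 * p ^ 2 - 4 * p * q - q ^ 2) / (p * (2 * p + 4 * q)) := by
      have : 2 * (p / q) ^ 2 + 4 * (p / q) ≠ 0 := by positivity
      have : p * (2 * p + 4 * q) ≠ 0 := by positivity
      field_simp
    rw [hrw, div_le_iff₀ (by positivity)] at h
    linarith

theorem sq_sum_abs_sub_le_klDiv {A : Type*} [Fintype A] {p q : A → ℝ}
    (hp : ∀ a, 0 ≤ p a) (hq : ∀ a, 0 < q a) (hps : ∑ a, p a = 1) (hqs : ∑ a, q a = 1) :
    (∑ a, |p a - q a|) ^ 2 ≤ 2 * Real.log 2 * klDiv p q := by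
  have hf : ∀ a ∈ univ, 0 ≤ (2 * p a + 4 * q a) / 3 := fun a _ => by
    have := hp a
    have := hq a
    positivity
  have hg : ∀ a ∈ univ, 0 ≤ p a * Real.log (p a / q a) - p a + q a := fun a _ => by
    refine nonneg_of_mul_nonneg_right
      ((sq_nonneg _).trans (sq_sub_le_mul_log_div (hp a) (hq a))) ?_
    have := hp a
    have := hq a
    positivity
  refine (sum_sq_le_sum_mul_sum_of_sq_le_mul univ hf hg fun a _ => ?_).trans_eq ?_
  · rw [sq_abs]
    exact sq_sub_le_mul_log_div (hp a) (hq a)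
  · have hlog : Real.log 2 ≠ 0 := (Real.log_pos one_lt_two).ne'
    have hkl : Real.log 2 * klDiv p q = ∑ a, p a * Real.log (p a / q a) := by
      rw [klDiv, mul_sum]
      refine sum_congr rfl fun a _ => ?_
      rw [Real.logb]
      field_simp
    rw [← sum_div, sum_add_distrib, ← mul_sum, ← mul_sum, sum_add_distrib, sum_sub_distrib,
      hps, hqs, mul_assoc, hkl]
    ring

theorem klDiv_self {A : Type*} [Fintype A] {p : A → ℝ} (hp : ∀ a, p a ≠ 0) :
    klDiv p p = 0 := by
  simp [klDiv, div_self (hp _)]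

end Pinsker

section ConditionallyComplete

theorem csSup_le_csSup_add {A B : Set ℝ} {c : ℝ} (hA : A.Nonempty) (hB : BddAbove B)
    (h : ∀ a ∈ A, ∃ b ∈ B, a ≤ b + c) : sSup A ≤ sSup B + c := by
  refine csSup_le hA fun a ha => ?_
  obtain ⟨b, hb, hab⟩ := h a ha
  linarith [le_csSup hB hb]

theorem abs_csInf_sub_le {A : Set ℝ} {y c : ℝ} (hA : A.Nonempty)
    (h : ∀ a ∈ A, |a - y| ≤ c) : |sInf A - y| ≤ c := by
  have hlb : y - c ∈ lowerBounds A := fun a ha => by linarith [(abs_le.mp (h a ha)).1]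
  obtain ⟨a, ha⟩ := hA
  rw [abs_le]
  constructor
  · linarith [le_csInf ⟨a, ha⟩ hlb]
  · linarith [csInf_le ⟨_, hlb⟩ ha, (abs_le.mp (h a ha)).2]

end ConditionallyComplete

section ValueFunction

variable {S : Type*} [Fintype S] {γ : ℝ} {Q : S → S → ℝ}

theorem abs_sum_mul_le {A : Type*} [Fintype A] {p x : A → ℝ} (hp : ∀ a, 0 ≤ p a) :
    |∑ a, p a * x a| ≤ ∑ a, p a * |x a| :=
  (abs_sum_le_sum_abs _ _).trans_eq
    (sum_congr rfl fun a _ => by rw [abs_mul, abs_of_nonneg (hp a)])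

theorem abs_le_div_of_abs_le_add (hγ0 : 0 ≤ γ) (hγ1 : γ < 1)
    (hQ : ∀ s s', 0 ≤ Q s s') (hQs : ∀ s, ∑ s', Q s s' = 1) {W : S → ℝ} {c : ℝ}
    (h : ∀ s, |W s| ≤ c + γ * |∑ s', Q s s' * W s'|) (s : S) : |W s| ≤ c / (1 - γ) := by
  obtain ⟨m, -, hm⟩ := exists_max_image univ (fun s => |W s|) ⟨s, mem_univ s⟩
  refine (hm s (mem_univ s)).trans ?_
  rw [le_div_iff₀ (by linarith)]
  have hle : |∑ s', Q m s' * W s'| ≤ |W m| :=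
    (abs_sum_mul_le (hQ m)).trans <|
      (sum_le_sum fun s' _ => mul_le_mul_of_nonneg_left (hm s' (mem_univ s')) (hQ m s')).trans_eq
        (by rw [← sum_mul, hQs, one_mul])
  linarith [h m, mul_le_mul_of_nonneg_left hle hγ0]

theorem abs_valueFunction_le (hγ0 : 0 ≤ γ) (hγ1 : γ < 1)
    (hQ : ∀ s s', 0 ≤ Q s s') (hQs : ∀ s, ∑ s', Q s s' = 1) {r V : S → ℝ} {M : ℝ}
    (hr : ∀ s, |r s| ≤ M) (hV : ∀ s, V s = r s + γ * ∑ s', Q s s' * V s') (s : S) :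
    |V s| ≤ M / (1 - γ) := by
  refine abs_le_div_of_abs_le_add hγ0 hγ1 hQ hQs (fun s => ?_) s
  calc |V s| = |r s + γ * ∑ s', Q s s' * V s'| := by rw [← hV s]
    _ ≤ |r s| + |γ * ∑ s', Q s s' * V s'| := abs_add_le _ _
    _ ≤ M + γ * |∑ s', Q s s' * V s'| := by
      rw [abs_mul, abs_of_nonneg hγ0]
      linarith [hr s]

theorem exists_valueFunction (hγ0 : 0 ≤ γ) (hγ1 : γ < 1)
    (hQ : ∀ s s', 0 ≤ Q s s') (hQs : ∀ s, ∑ s', Q s s' = 1) (r : S → ℝ) :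
    ∃ V : S → ℝ, ∀ s, V s = r s + γ * ∑ s', Q s s' * V s' := by
  let L : (S → ℝ) →ₗ[ℝ] S → ℝ := LinearMap.id - γ • Matrix.mulVecLin (Matrix.of Q)
  have hL : ∀ V s, L V s = V s - γ * ∑ s', Q s s' * V s' := fun _ _ => rfl
  have hinj : Function.Injective L := by
    rw [← LinearMap.ker_eq_bot, LinearMap.ker_eq_bot']
    intro V hV
    funext s
    have h := abs_valueFunction_le hγ0 hγ1 hQ hQs (r := 0) (V := V) (M := 0) (by simp)
      (fun s => by
        have := congrFun hV s
        rw [hL] at this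
        simp only [Pi.zero_apply] at this ⊢
        linarith) s
    rw [zero_div] at h
    exact abs_nonpos_iff.mp h
  obtain ⟨V, hV⟩ := LinearMap.injective_iff_surjective.mp hinj r
  refine ⟨V, fun s => ?_⟩
  rw [← hV, hL]
  ring

theorem abs_valueFunction_sub_le (hγ0 : 0 ≤ γ) (hγ1 : γ < 1)
    (hQ : ∀ s s', 0 ≤ Q s s') (hQs : ∀ s, ∑ s', Q s s' = 1)
    {Q' : S → S → ℝ} (hQ' : ∀ s s', 0 ≤ Q' s s') (hQs' : ∀ s, ∑ s', Q' s s' = 1)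
    {r V V' : S → ℝ} {M δ : ℝ} (hr : ∀ s, |r s| ≤ M)
    (hδ : ∀ s, ∑ s', |Q s s' - Q' s s'| ≤ δ)
    (hV : ∀ s, V s = r s + γ * ∑ s', Q s s' * V s')
    (hV' : ∀ s, V' s = r s + γ * ∑ s', Q' s s' * V' s') (s : S) :
    |V s - V' s| ≤ γ * δ * M / (1 - γ) ^ 2 := by
  have hM0 : 0 ≤ M := (abs_nonneg _).trans (hr s)
  have hB0 : 0 ≤ M / (1 - γ) := div_nonneg hM0 (by linarith)
  have hdiff : ∀ s, |∑ s', (Q s s' - Q' s s') * V s'| ≤ δ * (M / (1 - γ)) := fun s => by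
    refine (abs_sum_le_sum_abs _ _).trans ?_
    calc ∑ s', |(Q s s' - Q' s s') * V s'| ≤ ∑ s', |Q s s' - Q' s s'| * (M / (1 - γ)) :=
          sum_le_sum fun s' _ => by
            rw [abs_mul]
            exact mul_le_mul_of_nonneg_left
              (abs_valueFunction_le hγ0 hγ1 hQ hQs hr hV s') (abs_nonneg _)
      _ ≤ δ * (M / (1 - γ)) := by
          rw [← sum_mul]
          exact mul_le_mul_of_nonneg_right (hδ s) hB0
  refine (abs_le_div_of_abs_le_add (W := fun s => V s - V' s)
    (c := γ * (δ * (M / (1 - γ)))) hγ0 hγ1 hQ' hQs' (fun s => ?_) s).trans_eq ?_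
  · have heq : V s - V' s = γ * ∑ s', (Q s s' - Q' s s') * V s' +
        γ * ∑ s', Q' s s' * (V s' - V' s') := by
      simp only [sub_mul, mul_sub, sum_sub_distrib]
      linarith [hV s, hV' s]
    rw [heq]
    refine (abs_add_le _ _).trans ?_
    rw [abs_mul, abs_mul, abs_of_nonneg hγ0]
    exact add_le_add_left (mul_le_mul_of_nonneg_left (hdiff s) hγ0) _
  · have : 1 - γ ≠ 0 := by linarith
    field_simp

end ValueFunction

section InducedKernel

variable {S Aα Aν : Type*} [Fintype Aα] [Fintype Aν]

/-- The state transition kernel induced by an adversary and a victim policy. -/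
def inducedKernel (P : S → Aα → Aν → S → ℝ) (πα : S → Aα → ℝ) (πν : S → Aν → ℝ)
    (s s' : S) : ℝ :=
  ∑ aα, ∑ aν, πα s aα * πν s aν * P s aα aν s'

variable {P : S → Aα → Aν → S → ℝ} {πα : S → Aα → ℝ} {πν : S → Aν → ℝ}

theorem inducedKernel_nonneg (hP : ∀ s aα aν s', 0 ≤ P s aα aν s')
    (hα : ∀ s aα, 0 ≤ πα s aα) (hν : ∀ s aν, 0 ≤ πν s aν) (s s' : S) :
    0 ≤ inducedKernel P πα πν s s' :=
  sum_nonneg fun _ _ => sum_nonneg fun _ _ => mul_nonneg (mul_nonneg (hα _ _) (hν _ _)) (hP _ _ _ _)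

variable [Fintype S]

theorem sum_sum_sum_mul_eq (hPs : ∀ s aα aν, ∑ s', P s aα aν s' = 1)
    (hαs : ∀ s, ∑ aα, πα s aα = 1) (s : S) (x : Aν → ℝ) :
    ∑ s', ∑ aα, ∑ aν, πα s aα * x aν * P s aα aν s' = ∑ aν, x aν := by
  rw [sum_comm]
  simp_rw [sum_comm (s := (univ : Finset S)), ← mul_sum, hPs, mul_one, ← mul_sum, ← sum_mul,
    hαs, one_mul]

theorem sum_inducedKernel (hPs : ∀ s aα aν, ∑ s', P s aα aν s' = 1)
    (hαs : ∀ s, ∑ aα, πα s aα = 1) (hνs : ∀ s, ∑ aν, πν s aν = 1) (s : S) :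
    ∑ s', inducedKernel P πα πν s s' = 1 :=
  (sum_sum_sum_mul_eq hPs hαs s (πν s)).trans (hνs s)

theorem sum_abs_inducedKernel_sub_le (hP : ∀ s aα aν s', 0 ≤ P s aα aν s')
    (hPs : ∀ s aα aν, ∑ s', P s aα aν s' = 1)
    (hα : ∀ s aα, 0 ≤ πα s aα) (hαs : ∀ s, ∑ aα, πα s aα = 1) (πν' : S → Aν → ℝ) (s : S) :
    ∑ s', |inducedKernel P πα πν s s' - inducedKernel P πα πν' s s'| ≤
      ∑ aν, |πν s aν - πν' s aν| := by
  rw [← sum_sum_sum_mul_eq hPs hαs s fun aν => |πν s aν - πν' s aν|]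
  refine sum_le_sum fun s' _ => ?_
  simp only [inducedKernel, ← sum_sub_distrib, ← sub_mul, ← mul_sub]
  refine (abs_sum_le_sum_abs _ _).trans (sum_le_sum fun aα _ => ?_)
  refine (abs_sum_le_sum_abs _ _).trans_eq (sum_congr rfl fun aν _ => ?_)
  rw [abs_mul, abs_mul, abs_of_nonneg (hα s aα), abs_of_nonneg (hP s aα aν s')]

theorem optAdvValue_le_add [Nonempty Aα] (hP : ∀ s aα aν s', 0 ≤ P s aα aν s')
    (hPs : ∀ s aα aν, ∑ s', P s aα aν s' = 1) {γ : ℝ} (hγ0 : 0 ≤ γ) (hγ1 : γ < 1) (s₀ : S)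
    {r : S → ℝ} {M δ : ℝ} (hr : ∀ s, |r s| ≤ M)
    (hν : ∀ s aν, 0 ≤ πν s aν) (hνs : ∀ s, ∑ aν, πν s aν = 1)
    {πν' : S → Aν → ℝ} (hν' : ∀ s aν, 0 ≤ πν' s aν) (hνs' : ∀ s, ∑ aν, πν' s aν = 1)
    (hδ : ∀ s, ∑ aν, |πν s aν - πν' s aν| ≤ δ) :
    optAdvValue P r γ s₀ πν ≤ optAdvValue P r γ s₀ πν' + γ * δ * M / (1 - γ) ^ 2 := by
  refine csSup_le_csSup_add ?_ ?_ ?_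
  · classical
    obtain ⟨a⟩ := ‹Nonempty Aα›
    have hα : ∀ (s : S) aα, 0 ≤ (fun _ => Pi.single a 1 : S → Aα → ℝ) s aα := fun s aα =>
      (Pi.single_nonneg.mpr zero_le_one : (0 : Aα → ℝ) ≤ Pi.single a 1) aα
    have hαs : ∀ s : S, ∑ aα, (fun _ => Pi.single a 1 : S → Aα → ℝ) s aα = 1 := by simp
    obtain ⟨V, hV⟩ := exists_valueFunction hγ0 hγ1 (inducedKernel_nonneg hP hα hν)
      (sum_inducedKernel hPs hαs hνs) r
    exact ⟨V s₀, _, hα, hαs, V, hV, rfl⟩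
  · refine ⟨M / (1 - γ), ?_⟩
    rintro y ⟨πα, hα, hαs, V, hV, rfl⟩
    exact (le_abs_self _).trans (abs_valueFunction_le hγ0 hγ1 (inducedKernel_nonneg hP hα hν')
      (sum_inducedKernel hPs hαs hνs') hr hV s₀)
  · rintro y ⟨πα, hα, hαs, V, hV, rfl⟩
    obtain ⟨V', hV'⟩ := exists_valueFunction hγ0 hγ1 (inducedKernel_nonneg hP hα hν')
      (sum_inducedKernel hPs hαs hνs') r
    refine ⟨V' s₀, ⟨πα, hα, hαs, V', hV', rfl⟩, ?_⟩
    have h := abs_valueFunction_sub_le hγ0 hγ1 (inducedKernel_nonneg hP hα hν)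
      (sum_inducedKernel hPs hαs hνs) (inducedKernel_nonneg hP hα hν')
      (sum_inducedKernel hPs hαs hνs') hr
      (fun s => (sum_abs_inducedKernel_sub_le hP hPs hα hαs πν' s).trans (hδ s)) hV hV' s₀
    linarith [le_abs_self (V s₀ - V' s₀)]

theorem abs_optAdvValue_sub_le [Nonempty Aα] (hP : ∀ s aα aν s', 0 ≤ P s aα aν s')
    (hPs : ∀ s aα aν, ∑ s', P s aα aν s' = 1) {γ : ℝ} (hγ0 : 0 ≤ γ) (hγ1 : γ < 1) (s₀ : S)
    {r : S → ℝ} {M δ : ℝ} (hr : ∀ s, |r s| ≤ M)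
    (hν : ∀ s aν, 0 ≤ πν s aν) (hνs : ∀ s, ∑ aν, πν s aν = 1)
    {πν' : S → Aν → ℝ} (hν' : ∀ s aν, 0 ≤ πν' s aν) (hνs' : ∀ s, ∑ aν, πν' s aν = 1)
    (hδ : ∀ s, ∑ aν, |πν s aν - πν' s aν| ≤ δ) :
    |optAdvValue P r γ s₀ πν - optAdvValue P r γ s₀ πν'| ≤ γ * δ * M / (1 - γ) ^ 2 := by
  rw [abs_sub_le_iff, sub_le_iff_le_add', sub_le_iff_le_add']
  refine ⟨optAdvValue_le_add hP hPs hγ0 hγ1 s₀ hr hν hνs hν' hνs' hδ,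
    optAdvValue_le_add hP hPs hγ0 hγ1 s₀ hr hν' hνs' hν hνs fun s => ?_⟩
  simpa only [abs_sub_comm] using hδ s

end InducedKernel

theorem worst_case_adversary_training_bound
    {S Aα Aν : Type*} [Fintype S] [Nonempty S] [Fintype Aα] [Nonempty Aα]
    [Fintype Aν] [Nonempty Aν]
    (P : S → Aα → Aν → S → ℝ)
    (hPnn : ∀ s aα aν s', 0 ≤ P s aα aν s')
    (hPsum : ∀ s aα aν, ∑ s', P s aα aν s' = 1)
    (Δr : S → ℝ) (γ : ℝ) (hγ0 : 0 ≤ γ) (hγ1 : γ < 1) (s₀ : S)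
    (πν₀ : S → Aν → ℝ)
    (hπν₀pos : ∀ s aν, 0 < πν₀ s aν) (hπν₀sum : ∀ s, ∑ aν, πν₀ s aν = 1)
    (ε : ℝ) (hε : 0 < ε)
    (Y : ℝ)
    (hY : Y = sInf { y : ℝ | ∃ πν : S → Aν → ℝ,
      (∀ s aν, 0 ≤ πν s aν) ∧ (∀ s, ∑ aν, πν s aν = 1) ∧
      (∀ s, klDiv (πν s) (πν₀ s) ≤ ε) ∧
      y = optAdvValue P Δr γ s₀ πν })
    (Ystar : ℝ) (hYstar : Ystar = optAdvValue P Δr γ s₀ πν₀) :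
    |Y - Ystar| ≤
      γ * Real.sqrt (2 * Real.log 2) * (⨆ s, |Δr s|) / (1 - γ) ^ 2 *
        Real.sqrt ε := by
  obtain ⟨M, hM⟩ : ∃ M, M = ⨆ s, |Δr s| := ⟨_, rfl⟩
  have hr : ∀ s, |Δr s| ≤ M := fun s => hM ▸ le_ciSup (Set.finite_range fun s => |Δr s|).bddAbove s
  have hnear : ∀ πν : S → Aν → ℝ, (∀ s aν, 0 ≤ πν s aν) → (∀ s, ∑ aν, πν s aν = 1) →
      (∀ s, klDiv (πν s) (πν₀ s) ≤ ε) →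
      |optAdvValue P Δr γ s₀ πν - Ystar| ≤
        γ * Real.sqrt (2 * Real.log 2) * M / (1 - γ) ^ 2 * Real.sqrt ε := by
    intro πν hnn hsum hkl
    rw [hYstar]
    refine (abs_optAdvValue_sub_le hPnn hPsum hγ0 hγ1 s₀ hr hnn hsum
      (fun s aν => (hπν₀pos s aν).le) hπν₀sum
      (δ := Real.sqrt (2 * Real.log 2) * Real.sqrt ε) fun s => ?_).trans_eq (by ring)
    have hlog : 0 < Real.log 2 := Real.log_pos one_lt_two
    rw [← Real.sqrt_mul (by positivity)]
    refine Real.le_sqrt_of_sq_le ((sq_sum_abs_sub_le_klDiv (hnn s) (hπν₀pos s) (hsum s)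
      (hπν₀sum s)).trans ?_)
    exact mul_le_mul_of_nonneg_left (hkl s) (by positivity)
  rw [← hM, hY]
  refine abs_csInf_sub_le ?_ ?_
  · refine ⟨_, πν₀, fun s aν => (hπν₀pos s aν).le, hπν₀sum, fun s => ?_, rfl⟩
    rw [klDiv_self]
    · exact hε.le
    · exact fun a => (hπν₀pos s a).ne'
  · rintro y ⟨πν, hnn, hsum, hkl, rfl⟩
    exact hnear πν hnn hsum hkl
end
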